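/- arXiv:2012.09414 — 6 statements merged into one kernel-verified Lean document; each statement's English description precedes it below -/
import Mathlib

section
/- For every even natural number n, there exists p ∈ ℤ[X,Y] such that [n]_X = X·p and [n]_Y = Y·p; in particular X divides [n]_X, Y divides [n]_Y, and [n]_X/X = [n]_Y/Y. -/
/-- The polynomial ring `ℤ[X,Y]`, with the variable `X` indexed by `true` and
the variable `Y` indexed by `false`. -/
noncomputable abbrev TCQ.R₀ : Type := MvPolynomial Bool ℤ

/-- The two-colored quantum numbers `[n]_X, [n]_Y ∈ ℤ[X,Y]`.  The color `Z ∈ {X,Y}` is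
encoded as a `Bool` (`true` for `X`, `false` for `Y`), and `σ(Z)` is `!Z`.
They are defined by `[0]_Z = 0`, `[1]_Z = 1` and `[n+1]_Z = Z·[n]_{σ(Z)} − [n−1]_Z`. -/
noncomputable def TCQ.q : Bool → ℕ → TCQ.R₀
  | _, 0 => 0
  | _, 1 => 1
  | c, (n + 2) => MvPolynomial.X c * TCQ.q (!c) (n + 1) - TCQ.q c n

open TCQ in
theorem TCQ.q_add_two (c : Bool) (n : ℕ) :
    q c (n + 2) = MvPolynomial.X c * q (!c) (n + 1) - q c n := by
  rw [q]

open TCQ in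
/-- The even quantum numbers `[2k]_X` and `[2k]_Y` have a common cofactor of `X` and `Y`, and the
odd quantum numbers `[2k+1]_X` and `[2k+1]_Y` agree. -/
theorem TCQ.exists_q_two_mul_eq_and_q_odd_eq (k : ℕ) :
    (∃ p : R₀, q true (2 * k) = MvPolynomial.X true * p ∧
      q false (2 * k) = MvPolynomial.X false * p) ∧
    q true (2 * k + 1) = q false (2 * k + 1) := by
  induction k with
  | zero => exact ⟨⟨0, by simp [q]⟩, by simp [q]⟩
  | succ k ih =>
    obtain ⟨⟨p, hX, hY⟩, hodd⟩ := ih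
    have hX' : q true (2 * k + 2) = MvPolynomial.X true * (q false (2 * k + 1) - p) := by
      rw [q_add_two, hX, Bool.not_true]
      ring
    have hY' : q false (2 * k + 2) = MvPolynomial.X false * (q false (2 * k + 1) - p) := by
      rw [q_add_two, hY, Bool.not_false, hodd]
      ring
    refine ⟨⟨_, hX', hY'⟩, ?_⟩
    change q true (2 * k + 1 + 2) = q false (2 * k + 1 + 2)
    rw [q_add_two true, q_add_two false, Bool.not_true, Bool.not_false, hX', hY', hodd]
    ring

open TCQ in
/-- for every even natural number `n`, there is `p ∈ ℤ[X,Y]` with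
`[n]_X = X·p` and `[n]_Y = Y·p`; in particular `X ∣ [n]_X`, `Y ∣ [n]_Y` and
`[n]_X/X = [n]_Y/Y`. -/
theorem tcq_even_div (n : ℕ) (hn : Even n) :
    ∃ p : R₀, q true n = MvPolynomial.X true * p ∧ q false n = MvPolynomial.X false * p := by
  obtain ⟨k, rfl⟩ := hn
  rw [← two_mul]
  exact (exists_q_two_mul_eq_and_q_odd_eq k).1
end

section
/- For all m, n ∈ ℤ≥0 and Z ∈ {X,Y}, one has [m+n+1]_{σⁿ(Z)} = [m+1]_Z·[n+1]_{σ(Z)} − [m]_{σ(Z)}·[n]_Z in ℤ[X,Y]. -/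
open TCQ in
/-- `[m+n+1]_{σⁿ(Z)} = [m+1]_Z·[n+1]_{σ(Z)} − [m]_{σ(Z)}·[n]_Z`. -/
theorem tcq_add_formula (m n : ℕ) (Z : Bool) :
    q (Bool.not^[n] Z) (m + n + 1) = q Z (m + 1) * q (!Z) (n + 1) - q (!Z) m * q Z n := by
  induction n generalizing m Z with
  | zero => simp [q]
  | succ n ih =>
    have h := ih (m + 1) (!Z)
    rw [show m + 1 + n + 1 = m + (n + 1) + 1 by ring] at h
    rw [Function.iterate_succ_apply, h]
    simp only [q, Bool.not_not]
    ring
end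

section
/- For all m, n ∈ ℤ≥0 and Z ∈ {X,Y}, one has [m]_{σⁿ(Z)} = [m+n]_Z·[n+1]_{σ(Z)} − [m+n+1]_{σ(Z)}·[n]_Z in ℤ[X,Y]. -/
open TCQ in
/-- `[m]_{σⁿ(Z)} = [m+n]_Z·[n+1]_{σ(Z)} − [m+n+1]_{σ(Z)}·[n]_Z`. -/
theorem tcq_sub_formula (m n : ℕ) (Z : Bool) :
    q (Bool.not^[n] Z) m = q Z (m + n) * q (!Z) (n + 1) - q (!Z) (m + n + 1) * q Z n := by
  induction n generalizing Z with
  | zero => simp [q]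
  | succ n ih =>
    have q_add_two (k : ℕ) : q (!Z) (k + 2) = MvPolynomial.X (!Z) * q Z (k + 1) - q (!Z) k := by
      rw [q, Bool.not_not]
    rw [Function.iterate_succ_apply, ih, Bool.not_not, ← add_assoc, q_add_two n,
      q_add_two (m + n)]
    ring
end

section
/- For all m, n ∈ ℤ≥0 and Z ∈ {X,Y}, one has [m+n+1]_{σⁿ(Z)}·[m+n]_Z − [m+1]_Z·[m]_{σⁿ(Z)} = [n]_Z·[2m+n+1]_{σ^{m+1}(Z)} = [n]_{σⁿ(Z)}·[2m+n+1]_{σ^{n+m}(Z)} in ℤ[X,Y]. -/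
namespace TCQ

section Factors

variable {R : Type*} [CommRing R]

/-- The pair `(e, o)` of polynomials in `t = XY` with `[2k]_Z = Z·e` and `[2k+1]_Z = o`. -/
def factors (t : R) : ℕ → R × R
  | 0 => (0, 1)
  | k + 1 => ((factors t k).2 - (factors t k).1,
      t * ((factors t k).2 - (factors t k).1) - (factors t k).2)

theorem factors_add (t : R) (a b : ℕ) :
    (factors t (a + b)).1 = (factors t a).1 * (factors t b).2 + (factors t a).2 * (factors t b).1
        - t * (factors t a).1 * (factors t b).1 ∧
      (factors t (a + b)).2 = (factors t a).2 * (factors t b).2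
        - t * (factors t a).1 * (factors t b).1 := by
  induction b with
  | zero => simp [factors]
  | succ b ih =>
    rw [← add_assoc]
    simp only [factors, ih.1, ih.2]
    constructor <;> ring

theorem factors_cassini (t : R) (k : ℕ) :
    (factors t k).2 ^ 2 - t * (factors t k).1 * (factors t k).2 + t * (factors t k).1 ^ 2 = 1 := by
  induction k with
  | zero => simp [factors]
  | succ k ih =>
    simp only [factors]
    linear_combination ih

end Factors

theorem q_two_mul_and_succ (k : ℕ) (c : Bool) :
    q c (2 * k) = MvPolynomial.X c * (factors (MvPolynomial.X c * MvPolynomial.X !c) k).1 ∧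
      q c (2 * k + 1) = (factors (MvPolynomial.X c * MvPolynomial.X !c) k).2 := by
  induction k generalizing c with
  | zero => simp [q, factors]
  | succ k ih =>
    have even_succ (d : Bool) : q d (2 * (k + 1)) =
        MvPolynomial.X d * (factors (MvPolynomial.X d * MvPolynomial.X !d) (k + 1)).1 := by
      rw [show 2 * (k + 1) = 2 * k + 2 by ring, q, (ih (!d)).2, (ih d).1, Bool.not_not,
        mul_comm (MvPolynomial.X !d), factors]
      ring
    refine ⟨even_succ c, ?_⟩
    rw [show 2 * (k + 1) + 1 = 2 * k + 1 + 2 by ring, q,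
      show 2 * k + 1 + 1 = 2 * (k + 1) by ring, even_succ, (ih c).2, Bool.not_not,
      mul_comm (MvPolynomial.X !c) (MvPolynomial.X c), factors]
    ring

theorem q_two_mul (k : ℕ) (c : Bool) :
    q c (2 * k) = MvPolynomial.X c * (factors (MvPolynomial.X c * MvPolynomial.X !c) k).1 :=
  (q_two_mul_and_succ k c).1

theorem q_two_mul_add_one (k : ℕ) (c : Bool) :
    q c (2 * k + 1) = (factors (MvPolynomial.X c * MvPolynomial.X !c) k).2 :=
  (q_two_mul_and_succ k c).2

theorem not_iterate_two_mul (k : ℕ) (c : Bool) : Bool.not^[2 * k] c = c := by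
  rw [Bool.involutive_not.iterate_two_mul, id]

theorem not_iterate_two_mul_add_one (k : ℕ) (c : Bool) : Bool.not^[2 * k + 1] c = !c := by
  rw [Function.iterate_succ_apply, not_iterate_two_mul]

end TCQ

open TCQ in
/-- `[m+n+1]_{σⁿ(Z)}·[m+n]_Z − [m+1]_Z·[m]_{σⁿ(Z)}
  = [n]_Z·[2m+n+1]_{σ^{m+1}(Z)} = [n]_{σⁿ(Z)}·[2m+n+1]_{σ^{n+m}(Z)}`. -/
theorem tcq_product_difference (m n : ℕ) (Z : Bool) :
    (q (Bool.not^[n] Z) (m + n + 1) * q Z (m + n) - q Z (m + 1) * q (Bool.not^[n] Z) m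
      = q Z n * q (Bool.not^[m + 1] Z) (2 * m + n + 1)) ∧
    (q Z n * q (Bool.not^[m + 1] Z) (2 * m + n + 1)
      = q (Bool.not^[n] Z) n * q (Bool.not^[n + m] Z) (2 * m + n + 1)) := by
  obtain ⟨a, rfl | rfl⟩ := m.even_or_odd'
  all_goals obtain ⟨b, rfl | rfl⟩ := n.even_or_odd'
  · rw [show 2 * a + 2 * b + 1 = 2 * (a + b) + 1 by ring,
      show 2 * a + 2 * b = 2 * (a + b) by ring,
      show 2 * (2 * a) + 2 * b + 1 = 2 * (a + a + b) + 1 by ring,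
      show 2 * b + 2 * a = 2 * (a + b) by ring]
    simp only [not_iterate_two_mul, not_iterate_two_mul_add_one, q_two_mul, q_two_mul_add_one,
      Bool.not_not, mul_comm (MvPolynomial.X !Z) (MvPolynomial.X Z), factors_add, and_true]
    linear_combination (MvPolynomial.X Z *
      (factors (MvPolynomial.X Z * MvPolynomial.X !Z : R₀) a).1 *
      (factors (MvPolynomial.X Z * MvPolynomial.X !Z : R₀) a).2) *
      factors_cassini (MvPolynomial.X Z * MvPolynomial.X !Z : R₀) b
  · rw [show 2 * a + (2 * b + 1) + 1 = 2 * (a + b + 1) by ring,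
      show 2 * a + (2 * b + 1) = 2 * (a + b) + 1 by ring,
      show 2 * (2 * a) + (2 * b + 1) + 1 = 2 * (a + a + b + 1) by ring,
      show 2 * b + 1 + 2 * a = 2 * (a + b) + 1 by ring]
    simp only [not_iterate_two_mul_add_one, q_two_mul, q_two_mul_add_one,
      Bool.not_not, mul_comm (MvPolynomial.X !Z) (MvPolynomial.X Z), factors, factors_add, and_true]
    linear_combination (MvPolynomial.X (!Z) *
      (factors (MvPolynomial.X Z * MvPolynomial.X !Z : R₀) a).1 *
      (factors (MvPolynomial.X Z * MvPolynomial.X !Z : R₀) a).2) *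
      factors_cassini (MvPolynomial.X Z * MvPolynomial.X !Z : R₀) b
  · rw [show 2 * a + 1 + 2 * b + 1 = 2 * (a + b + 1) by ring,
      show 2 * a + 1 + 2 * b = 2 * (a + b) + 1 by ring,
      show 2 * (2 * a + 1) + 2 * b + 1 = 2 * (a + a + b + 1) + 1 by ring,
      show 2 * b + (2 * a + 1) = 2 * (a + b) + 1 by ring,
      show 2 * a + 1 + 1 = 2 * (a + 1) by ring]
    simp only [not_iterate_two_mul, not_iterate_two_mul_add_one, q_two_mul, q_two_mul_add_one,
      Bool.not_not, mul_comm (MvPolynomial.X !Z) (MvPolynomial.X Z), factors, factors_add, and_true]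
    linear_combination (MvPolynomial.X Z *
      ((factors (MvPolynomial.X Z * MvPolynomial.X !Z : R₀) a).2 -
        (factors (MvPolynomial.X Z * MvPolynomial.X !Z : R₀) a).1) *
      (factors (MvPolynomial.X Z * MvPolynomial.X !Z : R₀) a).2) *
      factors_cassini (MvPolynomial.X Z * MvPolynomial.X !Z : R₀) b
  · rw [show 2 * a + 1 + (2 * b + 1) + 1 = 2 * (a + b + 1) + 1 by ring,
      show 2 * a + 1 + (2 * b + 1) = 2 * (a + b + 1) by ring,
      show 2 * (2 * a + 1) + (2 * b + 1) + 1 = 2 * (a + a + b + 2) by ring,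
      show 2 * b + 1 + (2 * a + 1) = 2 * (a + b + 1) by ring,
      show 2 * a + 1 + 1 = 2 * (a + 1) by ring]
    simp only [not_iterate_two_mul, not_iterate_two_mul_add_one, q_two_mul, q_two_mul_add_one,
      Bool.not_not, mul_comm (MvPolynomial.X !Z) (MvPolynomial.X Z), factors, factors_add, and_true]
    linear_combination (MvPolynomial.X Z *
      ((factors (MvPolynomial.X Z * MvPolynomial.X !Z : R₀) a).2 -
        (factors (MvPolynomial.X Z * MvPolynomial.X !Z : R₀) a).1) *
      (factors (MvPolynomial.X Z * MvPolynomial.X !Z : R₀) a).2) *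
      factors_cassini (MvPolynomial.X Z * MvPolynomial.X !Z : R₀) b
end

section
/- For all integers 0 ≤ n ≤ m and Z ∈ {X,Y}, the product [n]_Z·[n−1]_Z⋯[1]_Z divides the product [m]_Z·[m−1]_Z⋯[m−n+1]_Z in ℤ[X,Y]; equivalently, the two-colored quantum binomial coefficient [m choose n]_Z = ([m]_Z [m−1]_Z ⋯ [m−n+1]_Z)/([n]_Z [n−1]_Z ⋯ [1]_Z) lies in ℤ[X,Y]. -/
namespace TCQ

theorem q_add_two_s7 (c : Bool) (n : ℕ) :
    q c (n + 2) = MvPolynomial.X c * q (!c) (n + 1) - q c n := by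
  rw [q]

/-- Odd two-colored quantum numbers do not depend on the color, and `[2k]_Z / Z` does not
depend on the color either. -/
theorem exists_q_even_odd (k : ℕ) :
    ∃ s o : R₀, ∀ c, q c (2 * k) = MvPolynomial.X c * s ∧ q c (2 * k + 1) = o := by
  induction k with
  | zero => exact ⟨0, 1, fun c => by simp [q]⟩
  | succ k ih =>
    obtain ⟨s, o, h⟩ := ih
    have even_eq (c : Bool) : q c (2 * k + 2) = MvPolynomial.X c * (o - s) := by
      rw [q_add_two_s7, (h _).2, (h _).1]; ring
    refine ⟨o - s, MvPolynomial.X true * MvPolynomial.X false * (o - s) - o,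
      fun c => ⟨even_eq c, ?_⟩⟩
    rw [show 2 * (k + 1) + 1 = 2 * k + 1 + 2 by ring, q_add_two_s7, even_eq, (h _).2]
    cases c <;> simp only [Bool.not_true, Bool.not_false] <;> ring

theorem q_odd_eq (c d : Bool) (k : ℕ) : q c (2 * k + 1) = q d (2 * k + 1) := by
  obtain ⟨s, o, h⟩ := exists_q_even_odd k
  rw [(h c).2, (h d).2]

theorem X_mul_q_even (c d : Bool) (k : ℕ) :
    MvPolynomial.X c * q d (2 * k) = MvPolynomial.X d * q c (2 * k) := by
  obtain ⟨s, o, h⟩ := exists_q_even_odd k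
  rw [(h c).1, (h d).1]; ring

theorem q_even_mul_q_even (c d : Bool) (k l : ℕ) :
    q c (2 * k) * q d (2 * l) = q d (2 * k) * q c (2 * l) := by
  obtain ⟨s, o, h⟩ := exists_q_even_odd k
  obtain ⟨s', o', h'⟩ := exists_q_even_odd l
  rw [(h c).1, (h d).1, (h' c).1, (h' d).1]; ring

/-- The color `c` if `n` is even, and the opposite color if `n` is odd. -/
def shift (c : Bool) (n : ℕ) : Bool := c ^^ decide (n % 2 = 1)

theorem shift_even (c : Bool) (k : ℕ) : shift c (2 * k) = c := by
  simp [shift]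

theorem shift_succ (c : Bool) (n : ℕ) : shift c (n + 1) = !shift c n := by
  rcases Nat.mod_two_eq_zero_or_one n with h | h <;> simp [shift, h, Nat.add_mod]

theorem q_add_two' (c : Bool) (n : ℕ) :
    q c (n + 2) = MvPolynomial.X (shift c n) * q c (n + 1) - q c n := by
  rw [q_add_two_s7]
  obtain ⟨k, rfl | rfl⟩ := n.even_or_odd'
  · rw [shift_even, q_odd_eq (!c) c]
  · rw [shift_succ, shift_even, show 2 * k + 1 + 1 = 2 * (k + 1) by ring, X_mul_q_even]

theorem q_add (c : Bool) (a b : ℕ) :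
    q c (a + b + 1) = q c (a + 1) * q (shift c a) (b + 1) - q c a * q (!shift c a) b := by
  induction a generalizing b with
  | zero => simp [q, shift]
  | succ a ih =>
    rw [show a + 1 + b + 1 = a + (b + 1) + 1 by ring, ih, shift_succ, Bool.not_not,
      q_add_two' c a, q_add_two_s7 (shift c a) b]
    ring

theorem exists_q_add_eq (c : Bool) (a b : ℕ) :
    ∃ u v : R₀, q c (a + b + 1) = u * q c (b + 1) + v * q c a := by
  rw [q_add]
  suffices ∃ u, q c (a + 1) * q (shift c a) (b + 1) = u * q c (b + 1) by
    obtain ⟨u, hu⟩ := this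
    exact ⟨u, -q (!shift c a) b, by rw [hu]; ring⟩
  obtain ⟨k, rfl | rfl⟩ := a.even_or_odd'
  · exact ⟨_, by rw [shift_even]⟩
  · obtain ⟨l, rfl | rfl⟩ := b.even_or_odd'
    · exact ⟨_, by rw [q_odd_eq _ c l]⟩
    · exact ⟨_, q_even_mul_q_even c _ (k + 1) (l + 1)⟩

end TCQ

open TCQ in
/-- for `0 ≤ n ≤ m`, the product `[n]_Z·[n−1]_Z⋯[1]_Z` divides
`[m]_Z·[m−1]_Z⋯[m−n+1]_Z` in `ℤ[X,Y]`, i.e. the two-colored quantum binomial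
coefficient `[m choose n]_Z` lies in `ℤ[X,Y]`. -/
theorem tcq_factorial_dvd (m n : ℕ) (h : n ≤ m) (Z : Bool) :
    (∏ i ∈ Finset.range n, q Z (i + 1)) ∣ ∏ i ∈ Finset.range n, q Z (m - i) := by
  induction m generalizing n with
  | zero => simp [Nat.le_zero.mp h]
  | succ m ih =>
    rcases n with _ | n
    · simp
    have hnm : n ≤ m := Nat.le_of_succ_le_succ h
    have step : ∏ i ∈ Finset.range (n + 1), q Z (m + 1 - i) =
        (∏ i ∈ Finset.range n, q Z (m - i)) * q Z (m + 1) := by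
      rw [Finset.prod_range_succ']
      simp
    have key := mul_dvd_mul_right (ih n hnm) (q Z (n + 1))
    rw [← Finset.prod_range_succ] at key
    rw [step]
    rcases hnm.eq_or_lt with rfl | hlt
    · exact key
    · obtain ⟨b, rfl⟩ := Nat.exists_eq_add_of_lt hlt
      obtain ⟨u, v, huv⟩ := exists_q_add_eq Z (n + 1) b
      have top := ih (n + 1) hlt
      rw [Finset.prod_range_succ (fun i => q Z (n + b + 1 - i)),
        show n + b + 1 - n = b + 1 by omega] at top
      rw [show n + b + 1 + 1 = n + 1 + b + 1 by ring, huv]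
      convert dvd_add (top.mul_left u) (key.mul_left v) using 1
      ring
end

section
/- For all integers m ≥ 1, n ≥ 0 and Z ∈ {X,Y}, one has [2m+n+1]_{σ^{m+1}(Z)}·[2m+n choose m−1]_{σⁿ(Z)} = [m]_{σⁿ(Z)}·[2m+n+1 choose m]_{σ^{n+1}(Z)} in ℤ[X,Y]. -/
/-- `binom` is the two-colored quantum binomial coefficient
`[m choose n]_Z = ([m]_Z [m−1]_Z ⋯ [m−n+1]_Z)/([n]_Z [n−1]_Z ⋯ [1]_Z) ∈ ℤ[X,Y]`, i.e.
it satisfies `[m choose n]_Z · ([n]_Z ⋯ [1]_Z) = [m]_Z ⋯ [m−n+1]_Z` for all `n ≤ m`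
(this determines it uniquely, `ℤ[X,Y]` being a domain and the quantum numbers nonzero). -/
def TCQ.IsBinom (binom : Bool → ℕ → ℕ → TCQ.R₀) : Prop :=
  ∀ (Z : Bool) (m n : ℕ), n ≤ m →
    binom Z m n * ∏ i ∈ Finset.range n, TCQ.q Z (i + 1) = ∏ i ∈ Finset.range n, TCQ.q Z (m - i)

namespace TCQ

/-- The color-independent part of the quantum numbers: `[n]_Z` is `colorless n` for odd `n` and
`Z * colorless n` for even `n`. -/
noncomputable def colorless : ℕ → R₀
  | 0 => 0
  | 1 => 1
  | (n + 2) =>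
    (if Even n then 1 else MvPolynomial.X true * MvPolynomial.X false) * colorless (n + 1)
      - colorless n

/-- The color-dependent factor of `[n]_Z`. -/
noncomputable def colorFactor (c : Bool) (n : ℕ) : R₀ :=
  MvPolynomial.X c ^ ((n + 1) % 2)

theorem q_eq_colorFactor_mul_colorless (c : Bool) (n : ℕ) :
    q c n = colorFactor c n * colorless n := by
  induction n using Nat.twoStepInduction generalizing c with
  | zero => simp [q, colorless]
  | one => simp [q, colorless, colorFactor]
  | more n ih₀ ih₁ =>
    rw [q, colorless, ih₀, ih₁]
    rcases Nat.even_or_odd n with h | h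
    · have h₁ : n % 2 = 0 := Nat.even_iff.mp h
      have h₂ : (n + 1) % 2 = 1 := by omega
      have h₃ : (n + 1 + 1) % 2 = 0 := by omega
      have h₄ : (n + 2 + 1) % 2 = 1 := by omega
      simp only [colorFactor, h, h₂, h₃, h₄, if_true]
      ring
    · have h₁ : n % 2 = 1 := Nat.odd_iff.mp h
      have h₂ : (n + 1) % 2 = 0 := by omega
      have h₃ : (n + 1 + 1) % 2 = 1 := by omega
      have h₄ : (n + 2 + 1) % 2 = 0 := by omega
      simp only [colorFactor, Nat.not_even_iff_odd.mpr h, h₂, h₃, h₄, if_false]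
      cases c <;> simp only [Bool.not_true, Bool.not_false] <;> ring

theorem eval_two_q (c : Bool) (n : ℕ) : MvPolynomial.eval (fun _ => (2 : ℤ)) (q c n) = n := by
  induction n using Nat.twoStepInduction generalizing c with
  | zero => simp [q]
  | one => simp [q]
  | more n ih₀ ih₁ =>
    simp only [q, map_sub, map_mul, MvPolynomial.eval_X, ih₀, ih₁]
    push_cast
    ring

theorem q_succ_ne_zero (c : Bool) (n : ℕ) : q c (n + 1) ≠ 0 := by
  intro h
  have h' := eval_two_q c (n + 1)
  rw [h, map_zero] at h'
  exact n.succ_ne_zero (by exact_mod_cast h'.symm)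

theorem prod_colorFactor_succ (c : Bool) (k : ℕ) :
    ∏ i ∈ Finset.range k, colorFactor c (i + 1) = MvPolynomial.X c ^ (k / 2) := by
  induction k with
  | zero => simp
  | succ k ih =>
    rw [Finset.prod_range_succ, ih, colorFactor, ← pow_add]
    congr 1
    omega

theorem prod_colorFactor_sub (c : Bool) {k N : ℕ} (hk : k ≤ N) :
    ∏ i ∈ Finset.range k, colorFactor c (N - i)
      = MvPolynomial.X c ^ ((k + (N + 1) % 2) / 2) := by
  induction k with
  | zero =>
    have : (0 + (N + 1) % 2) / 2 = 0 := by omega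
    rw [this]
    simp
  | succ k ih =>
    rw [Finset.prod_range_succ, ih (by omega), colorFactor, ← pow_add]
    congr 1
    omega

theorem iterate_not_eq (n : ℕ) (Z : Bool) :
    Bool.not^[n] Z = if n % 2 = 0 then Z else !Z := by
  induction n with
  | zero => simp
  | succ n ih =>
    rw [Function.iterate_succ_apply', ih]
    rcases Nat.mod_two_eq_zero_or_one n with h | h <;> simp [h, Nat.add_mod]

theorem colorFactor_prod_identity (k n N : ℕ) (hN : N = 2 * (k + 1) + n) (Z : Bool) :
    colorFactor (Bool.not^[k + 2] Z) (N + 1)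
        * (∏ i ∈ Finset.range k, colorFactor (Bool.not^[n] Z) (N - i))
        * ∏ i ∈ Finset.range (k + 1), colorFactor (Bool.not^[n + 1] Z) (i + 1)
      = colorFactor (Bool.not^[n + 1] Z) (N + 1)
        * (∏ i ∈ Finset.range k, colorFactor (Bool.not^[n + 1] Z) (N - i))
        * ∏ i ∈ Finset.range (k + 1), colorFactor (Bool.not^[n] Z) (i + 1) := by
  simp only [prod_colorFactor_succ, prod_colorFactor_sub _ (show k ≤ N by omega)]
  simp only [colorFactor, iterate_not_eq]
  obtain ⟨a, rfl | rfl⟩ := Nat.even_or_odd' k <;> obtain ⟨b, rfl | rfl⟩ := Nat.even_or_odd' n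
  · have e₁ : (N + 1) % 2 = 1 := by omega
    have e₂ : (N + 1 + 1) % 2 = 0 := by omega
    have e₃ : (2 * a + 1) / 2 = a := by omega
    simp only [e₁, e₂, e₃]
    ring
  · have e₁ : (N + 1) % 2 = 0 := by omega
    have e₂ : (N + 1 + 1) % 2 = 1 := by omega
    have e₃ : (2 * a + 1) / 2 = a := by omega
    have e₄ : (2 * a + 0) / 2 = a := by omega
    have e₅ : (2 * a + 2) % 2 = 0 := by omega
    have e₆ : (2 * b + 1 + 1) % 2 = 0 := by omega
    simp only [e₁, e₂, e₃, e₄, e₅, e₆, if_true]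
    ring
  · have e₁ : (N + 1) % 2 = 1 := by omega
    have e₂ : (N + 1 + 1) % 2 = 0 := by omega
    have e₃ : (2 * a + 1 + 1) / 2 = a + 1 := by omega
    simp only [e₁, e₂, e₃]
    ring
  · have e₁ : (N + 1) % 2 = 0 := by omega
    have e₂ : (N + 1 + 1) % 2 = 1 := by omega
    have e₃ : (2 * a + 1 + 1) / 2 = a + 1 := by omega
    have e₄ : (2 * a + 1 + 0) / 2 = a := by omega
    have e₅ : (2 * a + 1 + 2) % 2 = 1 := by omega
    have e₆ : (2 * b + 1 + 1) % 2 = 0 := by omega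
    have e₇ : (2 * b + 1) % 2 = 1 := by omega
    simp only [e₁, e₂, e₃, e₄, e₅, e₆, e₇, if_true, one_ne_zero, if_false]
    ring

theorem q_prod_identity (k n N : ℕ) (hN : N = 2 * (k + 1) + n) (Z : Bool) :
    q (Bool.not^[k + 2] Z) (N + 1)
        * (∏ i ∈ Finset.range k, q (Bool.not^[n] Z) (N - i))
        * ∏ i ∈ Finset.range (k + 1), q (Bool.not^[n + 1] Z) (i + 1)
      = q (Bool.not^[n + 1] Z) (N + 1)
        * (∏ i ∈ Finset.range k, q (Bool.not^[n + 1] Z) (N - i))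
        * ∏ i ∈ Finset.range (k + 1), q (Bool.not^[n] Z) (i + 1) := by
  simp only [q_eq_colorFactor_mul_colorless, Finset.prod_mul_distrib]
  linear_combination colorless (N + 1) * (∏ i ∈ Finset.range k, colorless (N - i))
    * (∏ i ∈ Finset.range (k + 1), colorless (i + 1)) * colorFactor_prod_identity k n N hN Z

end TCQ

open TCQ in
/-- for `m ≥ 1`, `n ≥ 0`,
`[2m+n+1]_{σ^{m+1}(Z)}·[2m+n choose m−1]_{σⁿ(Z)} = [m]_{σⁿ(Z)}·[2m+n+1 choose m]_{σ^{n+1}(Z)}`. -/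
theorem tcq_binom_ratio (binom : Bool → ℕ → ℕ → R₀) (hbinom : IsBinom binom)
    (m n : ℕ) (hm : 1 ≤ m) (Z : Bool) :
    q (Bool.not^[m + 1] Z) (2 * m + n + 1) * binom (Bool.not^[n] Z) (2 * m + n) (m - 1)
      = q (Bool.not^[n] Z) m * binom (Bool.not^[n + 1] Z) (2 * m + n + 1) m := by
  obtain ⟨k, rfl⟩ := Nat.exists_eq_add_of_le' hm
  rw [Nat.add_sub_cancel]
  obtain ⟨N, hN⟩ : ∃ N, N = 2 * (k + 1) + n := ⟨_, rfl⟩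
  rw [← hN]
  have h₁ := hbinom (Bool.not^[n] Z) N k (by omega)
  have h₂ := hbinom (Bool.not^[n + 1] Z) (N + 1) (k + 1) (by omega)
  have h₃ := q_prod_identity k n N hN Z
  rw [Finset.prod_range_succ' (fun i => q (Bool.not^[n + 1] Z) (N + 1 - i))] at h₂
  simp only [Nat.add_sub_add_right, Nat.sub_zero] at h₂
  rw [Finset.prod_range_succ (fun i => q (Bool.not^[n] Z) (i + 1))] at h₃
  have hD : ∏ i ∈ Finset.range k, q (Bool.not^[n] Z) (i + 1) ≠ 0 :=
    Finset.prod_ne_zero_iff.mpr fun i _ => q_succ_ne_zero _ i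
  have hE : ∏ i ∈ Finset.range (k + 1), q (Bool.not^[n + 1] Z) (i + 1) ≠ 0 :=
    Finset.prod_ne_zero_iff.mpr fun i _ => q_succ_ne_zero _ i
  apply mul_right_cancel₀ (mul_ne_zero hD hE)
  linear_combination q (Bool.not^[k + 2] Z) (N + 1)
      * (∏ i ∈ Finset.range (k + 1), q (Bool.not^[n + 1] Z) (i + 1)) * h₁
    - q (Bool.not^[n] Z) (k + 1) * (∏ i ∈ Finset.range k, q (Bool.not^[n] Z) (i + 1)) * h₂ + h₃
end
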